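/- (Example 1, concavity of f) Let δ ∈ (0, 1/2). The function f(ν) = 1/|log(1 − 2δ/(1+ν))| + 1/|log(1 − 2δ/(1−ν))| is concave on the open interval (−1+2δ, 1−2δ). -/

import Mathlib

theorem two_mul_le_mul_log_sub_log {c x : ℝ} (hc : 0 < c) (hx : c < x) :
    2 * c ≤ (2 * x - c) * (Real.log x - Real.log (x - c)) := by
  have hxc : 0 < x - c := sub_pos.2 hx
  have h := Real.le_log_one_add_of_nonneg (div_pos hc hxc).le
  have h₁ : 1 + c / (x - c) = x / (x - c) := by field_simp; ring
  have h₂ : 2 * (c / (x - c)) / (c / (x - c) + 2) = 2 * c / (2 * x - c) := by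
    have : 2 * x - c ≠ 0 := by linarith
    have : c / (x - c) + 2 = (2 * x - c) / (x - c) := by field_simp; ring
    rw [this]
    field_simp
  rw [h₁, h₂, Real.log_div (by linarith) hxc.ne', div_le_iff₀ (by linarith)] at h
  linarith

theorem concaveOn_inv_log_sub_log {c : ℝ} (hc : 0 < c) :
    ConcaveOn ℝ (Set.Ioi c) (fun x : ℝ => (Real.log x - Real.log (x - c))⁻¹) := by
  have hpos : ∀ x ∈ Set.Ioi c, 0 < Real.log x - Real.log (x - c) := fun x hx =>
    sub_pos.2 (Real.log_lt_log (sub_pos.2 hx) (by linarith))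
  have hlog : ∀ x ∈ Set.Ioi c, HasDerivAt (fun x : ℝ => Real.log x - Real.log (x - c))
      (1 / x - 1 / (x - c)) x := fun x hx => by
    have hx' : c < x := hx
    exact ((hasDerivAt_id x).log (by simp only [id]; linarith)).sub
      (((hasDerivAt_id x).sub_const c).log (by simp only [id]; linarith))
  have hderiv : ∀ x ∈ Set.Ioi c, HasDerivAt (fun x : ℝ => (Real.log x - Real.log (x - c))⁻¹)
      (-(1 / x - 1 / (x - c)) / (Real.log x - Real.log (x - c)) ^ 2) x := fun x hx =>
    (hlog x hx).inv (hpos x hx).ne'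
  have hderiv₂ : ∀ x ∈ Set.Ioi c, HasDerivAt
      (fun x : ℝ => -(1 / x - 1 / (x - c)) / (Real.log x - Real.log (x - c)) ^ 2)
      (-(c / (x ^ 2 * (x - c) ^ 2 * (Real.log x - Real.log (x - c)) ^ 3) *
        ((2 * x - c) * (Real.log x - Real.log (x - c)) - 2 * c))) x := fun x hx => by
    have hx' : c < x := hx
    have hx0 : x ≠ 0 := by linarith
    have hxc : x - c ≠ 0 := by linarith
    have hL := (hpos x hx).ne'
    have h := (((hasDerivAt_inv hx0).sub (((hasDerivAt_id x).sub_const c).inv hxc)).neg).div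
      ((hlog x hx).pow 2) (pow_ne_zero 2 hL)
    simp only [one_div]
    refine h.congr_deriv ?_
    simp only [Pi.neg_apply, Pi.sub_apply, Pi.inv_apply, Pi.pow_apply, id]
    generalize Real.log x - Real.log (x - c) = L at hL ⊢
    field_simp
    ring
  refine concaveOn_of_hasDerivWithinAt2_nonpos (convex_Ioi c)
    (fun x hx => (hderiv x hx).continuousAt.continuousWithinAt)
    (fun x hx => (hderiv x (interior_subset hx)).hasDerivWithinAt)
    (fun x hx => (hderiv₂ x (interior_subset hx)).hasDerivWithinAt) fun x hx => ?_
  have hx' : x ∈ Set.Ioi c := interior_subset hx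
  have := hpos x hx'
  exact neg_nonpos.2 (mul_nonneg (by positivity)
    (sub_nonneg.2 (two_mul_le_mul_log_sub_log hc hx')))

theorem concaveOn_one_div_neg_log_one_sub_div {c : ℝ} (hc : 0 < c) :
    ConcaveOn ℝ (Set.Ioi c) (fun x : ℝ => 1 / (-Real.log (1 - c / x))) := by
  refine (concaveOn_inv_log_sub_log hc).congr fun x hx => ?_
  have hx' : c < x := hx
  have hx0 : x ≠ 0 := by linarith
  have h : 1 - c / x = (x - c) / x := by field_simp
  simp only [h, Real.log_div (sub_pos.2 hx').ne' hx0, neg_sub, one_div]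

/-- **Example 1, concavity of `f`.** For `δ ∈ (0, 1/2)`, the function
`f(ν) = 1/|log(1 - 2δ/(1+ν))| + 1/|log(1 - 2δ/(1-ν))|` is concave on `(-1+2δ, 1-2δ)`. -/
theorem stmt_10 (δ : ℝ) (hδ0 : 0 < δ) (hδ1 : δ < 1 / 2) :
    ConcaveOn ℝ (Set.Ioo (-1 + 2 * δ) (1 - 2 * δ))
      (fun ν : ℝ => 1 / (-Real.log (1 - 2 * δ / (1 + ν)))
        + 1 / (-Real.log (1 - 2 * δ / (1 - ν)))) := by
  have hg := (concaveOn_one_div_neg_log_one_sub_div (c := 2 * δ) (by positivity)).2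
  refine ⟨convex_Ioo _ _, fun x hx y hy a b ha hb hab => ?_⟩
  have h₁ := hg (x := 1 + x) (Set.mem_Ioi.2 (by linarith [hx.1]))
    (y := 1 + y) (Set.mem_Ioi.2 (by linarith [hy.1])) ha hb hab
  have h₂ := hg (x := 1 - x) (Set.mem_Ioi.2 (by linarith [hx.2]))
    (y := 1 - y) (Set.mem_Ioi.2 (by linarith [hy.2])) ha hb hab
  have e₁ : a * (1 + x) + b * (1 + y) = 1 + (a * x + b * y) := by linear_combination hab
  have e₂ : a * (1 - x) + b * (1 - y) = 1 - (a * x + b * y) := by linear_combination hab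
  simp only [smul_eq_mul, e₁, e₂] at h₁ h₂ ⊢
  linarith
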